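/- Let t ∈ (0,1) and let L₀, L₁, L ∈ UC₋. If (1−t)·max{h_{L₀}(a) + 1, 0} + t·max{h_{L₁}(a) + 1, 0} = max{h_L(a) + 1, 0} for every a ∈ R̄₊ⁿ, then L₀ = L₁ = L. -/

import Mathlib

open Set MeasureTheory Pointwise

noncomputable section

abbrev En (n : ℕ) := EuclideanSpace ℝ (Fin n)

/-- Standard inner product on ℝⁿ. -/
def dotp {n : ℕ} (x y : En n) : ℝ := ∑ i, x i * y i

/-- Closed positive orthant R̄₊ⁿ. -/
def posOrthantCl (n : ℕ) : Set (En n) := {x | ∀ i, 0 ≤ x i}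
/-- Open positive orthant R₊ⁿ. -/
def posOrthantOp (n : ℕ) : Set (En n) := {x | ∀ i, 0 < x i}
/-- Closed negative orthant R̄₋ⁿ. -/
def negOrthantCl (n : ℕ) : Set (En n) := {x | ∀ i, x i ≤ 0}
/-- Open negative orthant R₋ⁿ. -/
def negOrthantOp (n : ℕ) : Set (En n) := {x | ∀ i, x i < 0}

/-- Copolar A° = {x : ⟨x,y⟩ ≤ −1 for all y ∈ A}. -/
def copolar {n : ℕ} (A : Set (En n)) : Set (En n) := {x | ∀ y ∈ A, dotp x y ≤ -1}

/-- Membership in C₊: closed convex subset of R̄₊ⁿ with A + R₊ⁿ ⊆ A. -/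
def memCplus {n : ℕ} (A : Set (En n)) : Prop :=
  IsClosed A ∧ Convex ℝ A ∧ A ⊆ posOrthantCl n ∧ A + posOrthantOp n ⊆ A

/-- Membership in C₋: closed convex subset of R̄₋ⁿ with A + R₋ⁿ ⊆ A. -/
def memCminus {n : ℕ} (A : Set (En n)) : Prop :=
  IsClosed A ∧ Convex ℝ A ∧ A ⊆ negOrthantCl n ∧ A + negOrthantOp n ⊆ A

/-- Membership in CC₊: member of C₊ with bounded complement in R̄₊ⁿ. -/
def memCCplus {n : ℕ} (P : Set (En n)) : Prop :=
  memCplus P ∧ Bornology.IsBounded (posOrthantCl n \ P)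

/-- Membership in UC₋: nonempty member of C₋ contained in s* + R̄₋ⁿ for some s* ∈ R₋ⁿ. -/
def memUCminus {n : ℕ} (L : Set (En n)) : Prop :=
  L.Nonempty ∧ memCminus L ∧ ∃ s ∈ negOrthantOp n, L ⊆ s +ᵥ negOrthantCl n

/-- Support function of a set, with values in EReal. -/
def suppFn {n : ℕ} (A : Set (En n)) (x : En n) : EReal := ⨆ y ∈ A, ((dotp x y : ℝ) : EReal)

/-- Legendre transform of an EReal-valued function. -/
def legendre {n : ℕ} (f : En n → EReal) (y : En n) : EReal :=
  ⨆ x, ((dotp x y : ℝ) : EReal) - f x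

section SupportFunction

variable {n : ℕ}

lemma dotp_eq_inner (x y : En n) : dotp x y = inner ℝ x y := by
  simp [dotp, PiLp.inner_apply, mul_comm]

lemma dotp_smul_left (r : ℝ) (x y : En n) : dotp (r • x) y = r * dotp x y := by
  simp [dotp_eq_inner, inner_smul_left]

lemma dotp_le_suppFn {A : Set (En n)} {y : En n} (hy : y ∈ A) (x : En n) :
    ((dotp x y : ℝ) : EReal) ≤ suppFn A x :=
  le_iSup₂_of_le y hy le_rfl

lemma suppFn_le {A : Set (En n)} {x : En n} {c : ℝ} (h : ∀ y ∈ A, dotp x y ≤ c) :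
    suppFn A x ≤ (c : EReal) :=
  iSup₂_le fun y hy => EReal.coe_le_coe_iff.mpr (h y hy)

lemma suppFn_smul {A : Set (En n)} {x : En n} {c r : ℝ} (hr : 0 < r)
    (h : suppFn A x = (c : EReal)) : suppFn A (r • x) = ((r * c : ℝ) : EReal) := by
  have upper : suppFn A (r • x) ≤ ((r * c : ℝ) : EReal) := by
    refine suppFn_le fun y hy => ?_
    have := dotp_le_suppFn hy x
    rw [h, EReal.coe_le_coe_iff] at this
    rw [dotp_smul_left]
    gcongr
  refine le_antisymm upper (le_of_forall_lt fun b hb => ?_)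
  by_contra! hle
  obtain ⟨q, hbq, hqc⟩ := EReal.lt_iff_exists_real_btwn.mp hb
  have hq : suppFn A x ≤ ((q / r : ℝ) : EReal) := by
    refine suppFn_le fun y hy => ?_
    have := ((dotp_le_suppFn hy (r • x)).trans hle).trans hbq.le
    rw [EReal.coe_le_coe_iff, dotp_smul_left] at this
    rwa [le_div_iff₀' hr]
  rw [h, EReal.coe_le_coe_iff, le_div_iff₀' hr] at hq
  exact absurd hq (not_le.mpr (EReal.coe_lt_coe_iff.mp hqc))

lemma dotp_neg_of_pos_of_neg {x s : En n} (hx : x ∈ posOrthantCl n) (hx0 : x ≠ 0)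
    (hs : s ∈ negOrthantOp n) : dotp x s < 0 := by
  obtain ⟨i, hi⟩ : ∃ i, x i ≠ 0 := by
    by_contra! h
    exact hx0 (by ext i; simpa using h i)
  refine Finset.sum_neg' (fun j _ => mul_nonpos_of_nonneg_of_nonpos (hx j) (hs j).le)
    ⟨i, Finset.mem_univ i, mul_neg_of_pos_of_neg (lt_of_le_of_ne (hx i) (Ne.symm hi)) (hs i)⟩

lemma memUCminus.exists_suppFn_eq {L : Set (En n)} (hL : memUCminus L) {x : En n}
    (hx : x ∈ posOrthantCl n) (hx0 : x ≠ 0) : ∃ c : ℝ, 0 < c ∧ suppFn L x = ((-c : ℝ) : EReal) := by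
  obtain ⟨⟨y, hy⟩, -, s, hs, hLs⟩ := hL
  have hle : suppFn L x ≤ ((dotp x s : ℝ) : EReal) := by
    refine suppFn_le fun z hz => ?_
    obtain ⟨w, hw, rfl⟩ := hLs hz
    refine Finset.sum_le_sum fun i _ => mul_le_mul_of_nonneg_left ?_ (hx i)
    simpa using hw i
  have hge := dotp_le_suppFn hy x
  have hneg := dotp_neg_of_pos_of_neg hx hx0 hs
  lift suppFn L x to ℝ using
    ⟨ne_top_of_le_ne_top (EReal.coe_ne_top _) hle, ne_bot_of_le_ne_bot (EReal.coe_ne_bot _) hge⟩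
    with c
  exact ⟨-c, by linarith [EReal.coe_le_coe_iff.mp hle], by simp⟩

lemma suppFn_zero {A : Set (En n)} (hA : A.Nonempty) : suppFn A 0 = 0 := by
  simp [suppFn, dotp, biSup_const hA]

/-- A linear functional bounded above on a nonempty set stable under adding negative vectors
has nonnegative coordinates. -/
lemma mem_posOrthantCl_of_forall_dotp_le {A : Set (En n)} (hA : A.Nonempty)
    (hadd : A + negOrthantOp n ⊆ A) {x : En n} {u : ℝ} (h : ∀ y ∈ A, dotp x y ≤ u) :
    x ∈ posOrthantCl n := by
  intro i
  by_contra! hi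
  obtain ⟨y, hy⟩ := hA
  set o : En n := WithLp.toLp 2 fun _ => -1 with ho
  obtain ⟨k, hk⟩ := exists_nat_gt ((u - dotp x y - dotp x o) / -x i)
  rw [div_lt_iff₀ (by linarith)] at hk
  have hv : o + EuclideanSpace.single i (-(k : ℝ)) ∈ negOrthantOp n := by
    intro j
    by_cases hj : j = i
    · subst hj
      simp [ho]
      linarith [Nat.cast_nonneg (α := ℝ) k]
    · simp [ho, hj]
  have := h _ (hadd (add_mem_add hy hv))
  simp only [dotp_eq_inner, inner_add_right, EuclideanSpace.inner_single_right] at this hk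
  simp at this
  linarith

lemma subset_of_suppFn_le {A B : Set (En n)} (hB : B.Nonempty) (hBc : memCminus B)
    (h : ∀ a ∈ posOrthantCl n, suppFn A a ≤ suppFn B a) : A ⊆ B := by
  intro z hz
  by_contra hzB
  obtain ⟨f, u, hf, hu⟩ := geometric_hahn_banach_closed_point hBc.2.1 hBc.1 hzB
  set x : En n := (InnerProductSpace.toDual ℝ (En n)).symm f
  have hfx : ∀ y, f y = dotp x y := fun y => by
    rw [dotp_eq_inner, InnerProductSpace.toDual_symm_apply]
  simp only [hfx] at hf hu
  have hB' : ∀ y ∈ B, dotp x y ≤ u := fun y hy => (hf y hy).le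
  have hx := mem_posOrthantCl_of_forall_dotp_le hB hBc.2.2.2 hB'
  have := ((dotp_le_suppFn hz x).trans (h x hx)).trans (suppFn_le hB')
  exact absurd (EReal.coe_le_coe_iff.mp this) (not_le.mpr hu)

lemma eq_of_suppFn_eq {A B : Set (En n)} (hA : memUCminus A) (hB : memUCminus B)
    (h : ∀ a ∈ posOrthantCl n, suppFn A a = suppFn B a) : A = B :=
  (subset_of_suppFn_le hB.1 hB.2.1 fun a ha => (h a ha).le).antisymm
    (subset_of_suppFn_le hA.1 hA.2.1 fun a ha => (h a ha).ge)

end SupportFunction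

/-- If the profiles `r ↦ max (1 - r c) 0` satisfy an affine relation, the slopes agree. -/
lemma slopes_eq_of_max_affine {t c₀ c₁ c : ℝ} (ht : t ∈ Set.Ioo (0 : ℝ) 1) (h₀ : 0 < c₀)
    (h₁ : 0 < c₁) (hc : 0 < c)
    (h : ∀ r : ℝ, 0 < r → (1 - t) * max (r * -c₀ + 1) 0 + t * max (r * -c₁ + 1) 0
      = max (r * -c + 1) 0) : c₀ = c ∧ c₁ = c := by
  obtain ⟨ht0, ht1⟩ := ht
  have hsum : (1 - t) * c₀ + t * c₁ = c := by
    have hS : 0 < c₀ + c₁ + c := by positivity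
    have hS' := h (c₀ + c₁ + c)⁻¹ (by positivity)
    have aux : ∀ d, d ≤ c₀ + c₁ + c → 0 ≤ (c₀ + c₁ + c)⁻¹ * -d + 1 := fun d hd => by
      have := (div_le_one hS).mpr hd
      rw [div_eq_inv_mul] at this
      linarith
    rw [max_eq_left (aux _ (by linarith)), max_eq_left (aux _ (by linarith)),
      max_eq_left (aux _ (by linarith))] at hS'
    field_simp at hS'
    linarith
  have hr := h c⁻¹ (by positivity)
  rw [show c⁻¹ * -c + 1 = 0 by field_simp; ring, max_self] at hr
  have le_of : ∀ d, max (c⁻¹ * -d + 1) 0 ≤ 0 → c ≤ d := fun d hd => by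
    have := (le_max_left _ _).trans hd
    field_simp at this
    linarith
  have hm₀ := le_max_right (c⁻¹ * -c₀ + 1) 0
  have hm₁ := le_max_right (c⁻¹ * -c₁ + 1) 0
  have hc₀ : c ≤ c₀ := le_of c₀ (by nlinarith [mul_nonneg ht0.le hm₁])
  have hc₁ : c ≤ c₁ := le_of c₁ (by nlinarith [mul_nonneg (sub_pos.mpr ht1).le hm₀])
  constructor <;> nlinarith

/-- For t ∈ (0,1) and L₀, L₁, L ∈ UC₋, if
(1−t)·max{h_{L₀}+1, 0} + t·max{h_{L₁}+1, 0} = max{h_L+1, 0} on R̄₊ⁿ, then L₀ = L₁ = L. -/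
theorem eq_of_cutoff_affine (n : ℕ) (hn : 1 ≤ n) (t : ℝ) (ht : t ∈ Set.Ioo (0:ℝ) 1)
    (L0 L1 L : Set (En n)) (h0 : memUCminus L0) (h1 : memUCminus L1) (hL : memUCminus L)
    (heq : ∀ a ∈ posOrthantCl n,
      ((1 - t : ℝ) : EReal) * max (suppFn L0 a + 1) 0
        + ((t : ℝ) : EReal) * max (suppFn L1 a + 1) 0
      = max (suppFn L a + 1) 0) :
    L0 = L1 ∧ L1 = L := by
  have key : ∀ a ∈ posOrthantCl n, suppFn L0 a = suppFn L a ∧ suppFn L1 a = suppFn L a := by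
    intro a ha
    rcases eq_or_ne a 0 with rfl | ha0
    · simp [suppFn_zero h0.1, suppFn_zero h1.1, suppFn_zero hL.1]
    obtain ⟨c₀, hc₀, e₀⟩ := h0.exists_suppFn_eq ha ha0
    obtain ⟨c₁, hc₁, e₁⟩ := h1.exists_suppFn_eq ha ha0
    obtain ⟨c, hc, e⟩ := hL.exists_suppFn_eq ha ha0
    obtain ⟨rfl, rfl⟩ := slopes_eq_of_max_affine ht hc₀ hc₁ hc fun r hr => by
      have := heq (r • a) fun i => mul_nonneg hr.le (ha i)
      rw [suppFn_smul hr e₀, suppFn_smul hr e₁, suppFn_smul hr e, ← EReal.coe_one,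
        ← EReal.coe_zero] at this
      simp only [← EReal.coe_add, ← EReal.coe_strictMono.monotone.map_max, ← EReal.coe_mul] at this
      exact EReal.coe_eq_coe_iff.mp this
    exact ⟨e₀.trans e.symm, e₁.trans e.symm⟩
  exact ⟨eq_of_suppFn_eq h0 h1 fun a ha => (key a ha).1.trans (key a ha).2.symm,
    eq_of_suppFn_eq h1 hL fun a ha => (key a ha).2⟩
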